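/- arXiv:2004.01471 — 2 statements merged into one kernel-verified Lean document; each statement's English description precedes it below -/
import Mathlib

section
/- Let b ≥ 1 be a natural number and let ‖·‖ be a norm on ℝ^b. Let S = {f : ℝ^b → ℝ linear | f(x) ≤ ‖x‖ for all x ∈ ℝ^b} be the dual unit ball, and suppose that the set A of extreme points of S is finite. Then the set of extreme points of the unit ball B = {x ∈ ℝ^b : ‖x‖ ≤ 1} is finite and has cardinality at most (card A)^b. -/
open Filter Topology

/-- A seminorm on a real vector space is attained at each point by a linear functional
which it dominates. -/
theorem Seminorm.exists_linearMap_le_apply_eq {E : Type*} [AddCommGroup E] [Module ℝ E]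
    (N : Seminorm ℝ E) (x : E) : ∃ f : E →ₗ[ℝ] ℝ, (∀ z, f z ≤ N z) ∧ f x = N x := by
  rcases eq_or_ne x 0 with rfl | hx
  · exact ⟨0, fun z => by simp, by simp⟩
  obtain ⟨g, hg, hgN⟩ := exists_extension_of_le_sublinear
    (LinearPMap.mkSpanSingleton x (N x) hx) N
    (fun c hc z => by rw [map_smul_eq_mul, Real.norm_of_nonneg hc.le])
    (fun y z => map_add_le_add N y z) (by
      rintro ⟨z, hz⟩
      obtain ⟨c, rfl⟩ := Submodule.mem_span_singleton.1 hz
      refine (LinearPMap.mkSpanSingleton'_apply _ _ _ c hz).trans_le ?_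
      rw [map_smul_eq_mul, smul_eq_mul, RingHom.id_apply]
      exact mul_le_mul_of_nonneg_right (le_abs_self c) (apply_nonneg N x))
  refine ⟨g, hgN, ?_⟩
  have h := hg ⟨x, Submodule.mem_span_singleton_self x⟩
  rwa [LinearPMap.mkSpanSingleton_apply] at h

/-- A seminorm on `ι → ℝ` is attained at each point by an extreme point of its dual unit ball. -/
theorem Seminorm.exists_mem_extremePoints_apply_eq {ι : Type*} [Fintype ι]
    (N : Seminorm ℝ (ι → ℝ)) (x : ι → ℝ) :
    ∃ f ∈ Set.extremePoints ℝ {f : (ι → ℝ) →ₗ[ℝ] ℝ | ∀ z, f z ≤ N z}, f x = N x := by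
  classical
  let e := dotProductEquiv ℝ ι
  let K : Set (ι → ℝ) := {y | (∀ z, y ⬝ᵥ z ≤ N z) ∧ y ⬝ᵥ x = N x}
  have hmem : ∀ {h : (ι → ℝ) →ₗ[ℝ] ℝ}, (∀ z, h z ≤ N z) → h x = N x → e.symm h ∈ K := by
    intro h hh hhx
    have h' : ∀ z, e.symm h ⬝ᵥ z = h z := fun z =>
      LinearMap.congr_fun (e.apply_symm_apply h) z
    simpa only [K, Set.mem_ofPred_eq, h'] using And.intro hh hhx
  have hne : K.Nonempty := by
    obtain ⟨f, hf, hfx⟩ := N.exists_linearMap_le_apply_eq x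
    exact ⟨e.symm f, hmem hf hfx⟩
  have hclosed : IsClosed K := by
    simp only [K, Set.ofPred_and, Set.ofPred_forall]
    refine IsClosed.inter (isClosed_iInter fun z => isClosed_le ?_ continuous_const)
      (isClosed_eq ?_ continuous_const)
    all_goals exact Continuous.dotProduct continuous_id continuous_const
  have hcompact : IsCompact K := by
    refine (isCompact_univ_pi fun i => isCompact_Icc
      (a := -N (Pi.single i 1)) (b := N (Pi.single i 1))).of_isClosed_subset hclosed ?_
    intro y hy i _
    have h₁ := hy.1 (Pi.single i 1)
    have h₂ := hy.1 (-Pi.single i 1)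
    rw [map_neg_eq_map, dotProduct_neg, dotProduct_single_one] at h₂
    rw [dotProduct_single_one] at h₁
    exact ⟨by linarith, h₁⟩
  obtain ⟨y, hy⟩ := hcompact.extremePoints_nonempty hne
  refine ⟨e y, ⟨hy.1.1, ?_⟩, hy.1.2⟩
  rintro f hf g hg ⟨s, t, hs, ht, hst, hfg⟩
  have hx : s * f x + t * g x = N x := by
    have h := LinearMap.congr_fun hfg x
    exact h.trans hy.1.2
  have hNx : s * N x + t * N x = N x := by rw [← add_mul, hst, one_mul]
  have hfx : f x = N x := by
    refine le_antisymm (hf x) ?_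
    by_contra! hlt
    linarith [mul_lt_mul_of_pos_left hlt hs, mul_le_mul_of_nonneg_left (hg x) ht.le]
  have hgx : g x = N x := by
    refine le_antisymm (hg x) ?_
    by_contra! hlt
    linarith [mul_lt_mul_of_pos_left hlt ht, mul_le_mul_of_nonneg_left (hf x) hs.le]
  have hseg : y ∈ openSegment ℝ (e.symm f) (e.symm g) :=
    ⟨s, t, hs, ht, hst, by rw [← map_smul, ← map_smul, ← map_add, hfg, e.symm_apply_apply]⟩
  rw [← hy.2 (hmem hf hfx) (hmem hg hgx) hseg, e.apply_symm_apply]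

/-- If the unit ball of a seminorm on a finite-dimensional space is cut out by finitely many
functionals, those which are tight at an extreme point span the dual space. -/
theorem Seminorm.span_tight_eq_top {E : Type*} [AddCommGroup E] [Module ℝ E]
    [FiniteDimensional ℝ E] (N : Seminorm ℝ E) {A : Set (E →ₗ[ℝ] ℝ)} (hA : A.Finite)
    (hAN : ∀ f ∈ A, ∀ z, f z ≤ N z) (hNA : ∀ z, ∃ f ∈ A, f z = N z) {x : E}
    (hx : x ∈ Set.extremePoints ℝ {z | N z ≤ 1}) :
    Submodule.span ℝ {f ∈ A | f x = 1} = (⊤ : Submodule ℝ (Module.Dual ℝ E)) := by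
  rw [← Subspace.dualCoannihilator_dualAnnihilator_eq (W := Submodule.span ℝ {f ∈ A | f x = 1}),
    Submodule.dualAnnihilator_eq_top_iff, Submodule.eq_bot_iff]
  intro v hv
  rw [Submodule.mem_dualCoannihilator] at hv
  have hsmall : ∀ w : E, (∀ f ∈ A, f x = 1 → f w = 0) →
      ∀ᶠ ε : ℝ in 𝓝[>] 0, N (x + ε • w) ≤ 1 := by
    intro w hw
    have h : ∀ᶠ ε : ℝ in 𝓝[>] 0, ∀ f ∈ A, f (x + ε • w) ≤ 1 := by
      refine (eventually_all_finite hA).2 fun f hf => ?_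
      simp only [map_add, map_smul, smul_eq_mul]
      rcases ((hAN f hf x).trans hx.1).eq_or_lt with h | h
      · simp [h, hw f hf h]
      · have hc : Tendsto (fun ε : ℝ => f x + ε * f w) (𝓝[>] 0) (𝓝 (f x)) := by
          refine Tendsto.mono_left ?_ nhdsWithin_le_nhds
          have : Continuous fun ε : ℝ => f x + ε * f w := by fun_prop
          simpa using this.tendsto 0
        exact (hc.eventually_lt_const h).mono fun _ => le_of_lt
    filter_upwards [h] with ε hε
    obtain ⟨f, hf, hfx⟩ := hNA (x + ε • w)
    exact hfx ▸ hε f hf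
  have htight : ∀ f ∈ A, f x = 1 → f v = 0 := fun f hf hfx =>
    hv f (Submodule.subset_span ⟨hf, hfx⟩)
  obtain ⟨ε, ⟨h₁, h₂⟩, hε⟩ := (((hsmall v htight).and (hsmall (-v) fun f hf hfx => by
    rw [map_neg, htight f hf hfx, neg_zero])).and self_mem_nhdsWithin).exists
  have hseg : x ∈ openSegment ℝ (x + ε • v) (x + ε • -v) :=
    ⟨1 / 2, 1 / 2, by norm_num, by norm_num, by norm_num, by module⟩
  have h := hx.2 h₁ h₂ hseg
  exact (smul_eq_zero.1 (left_eq_add.1 h.symm)).resolve_left (ne_of_gt hε)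

/-- Let `b ≥ 1` and let `N` be a norm on `ℝ^b` (a seminorm with `N x = 0 → x = 0`).
Let `S` be the dual unit ball, and suppose the set `A` of extreme points of `S` is finite.
Then the set of extreme points of the unit ball `B = {x | N x ≤ 1}` is finite and has
cardinality at most `(card A)^b`. -/
theorem primal_ball_extreme_points_bound (b : ℕ) (hb : 1 ≤ b)
    (N : Seminorm ℝ (Fin b → ℝ)) (hN : ∀ x, N x = 0 → x = 0)
    (S : Set ((Fin b → ℝ) →ₗ[ℝ] ℝ))
    (hS : S = { f : (Fin b → ℝ) →ₗ[ℝ] ℝ | ∀ x, f x ≤ N x })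
    (A : Set ((Fin b → ℝ) →ₗ[ℝ] ℝ)) (hA : A = Set.extremePoints ℝ S)
    (hAfin : A.Finite) :
    (Set.extremePoints ℝ { x : Fin b → ℝ | N x ≤ 1 }).Finite ∧
    (Set.extremePoints ℝ { x : Fin b → ℝ | N x ≤ 1 }).ncard ≤ A.ncard ^ b := by
  subst hS
  have hAN : ∀ f ∈ A, ∀ z, f z ≤ N z := by
    intro f hf
    rw [hA] at hf
    exact hf.1
  have hNA : ∀ z, ∃ f ∈ A, f z = N z := fun z => hA ▸ N.exists_mem_extremePoints_apply_eq z
  have hbasis : ∀ x : Set.extremePoints ℝ {x : Fin b → ℝ | N x ≤ 1}, ∃ g : Fin b → A,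
      (∀ i, (g i).1 x = 1) ∧ Submodule.span ℝ (Set.range fun i => (g i).1) = ⊤ := by
    rintro ⟨x, hx⟩
    have htop := N.span_tight_eq_top hAfin hAN hNA hx
    obtain ⟨g, hg, hspan, -⟩ :=
      Submodule.exists_fun_fin_finrank_span_eq ℝ {f ∈ A | f x = 1}
    have hrank : Module.finrank ℝ (Submodule.span ℝ {f ∈ A | f x = 1}) = b := by
      rw [htop, finrank_top, Subspace.dual_finrank_eq, Module.finrank_fin_fun]
    let e := finCongr hrank.symm
    refine ⟨fun i => ⟨g (e i), (hg (e i)).1⟩, fun i => (hg (e i)).2, ?_⟩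
    exact (congrArg (Submodule.span ℝ) (e.surjective.range_comp g)).trans (hspan.trans htop)
  choose g hg hspan using hbasis
  have hinj : Function.Injective g := by
    intro x y hxy
    refine Subtype.ext (sub_eq_zero.1 ((Module.forall_dual_apply_eq_zero_iff ℝ _).1 fun f => ?_))
    have hle : Submodule.span ℝ (Set.range fun i => (g x i).1) ≤
        LinearMap.ker (Module.Dual.eval ℝ _ (x.1 - y.1)) := by
      rw [Submodule.span_le]
      rintro _ ⟨i, rfl⟩
      have h := hg y i
      rw [← hxy] at h
      simp [hg x i, h]
    exact hle (hspan x ▸ Submodule.mem_top)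
  have := hAfin.to_subtype
  refine ⟨Set.finite_coe_iff.1 (Finite.of_injective g hinj), ?_⟩
  simpa [Nat.card_fun, Nat.card_coe_set_eq] using Nat.card_le_card_of_injective g hinj
end

section
/- Let d ≥ 1 and let s be a finite subset of ℝ^d whose convex hull has nonempty interior. Then there exists a geometric simplicial complex K in ℝ^d whose vertex set is contained in s and whose underlying space (the union of its faces) equals the topological boundary of the convex hull of s. -/
/-- On a nonempty compact set, a finite family of continuous real functions attains a
lexicographic maximum. -/
theorem IsCompact.exists_isLexMax {X : Type*} [TopologicalSpace X] {n : ℕ} (g : Fin n → X → ℝ)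
    (hg : ∀ i, Continuous (g i)) {W : Set X} (hW : IsCompact W) (hne : W.Nonempty) :
    ∃ w ∈ W, ∀ w' ∈ W, toLex (fun i => g i w') ≤ toLex (fun i => g i w) := by
  induction n generalizing W with
  | zero =>
    obtain ⟨w, hw⟩ := hne
    exact ⟨w, hw, fun w' _ => le_of_eq (congrArg toLex (Subsingleton.elim _ _))⟩
  | succ n ih =>
    obtain ⟨m, hm, hmax⟩ := hW.exists_isMaxOn hne (hg 0).continuousOn
    obtain ⟨w, hw, hwmax⟩ := ih (fun i => g i.succ) (fun i => hg _)
      (hW.inter_right (isClosed_eq (hg 0) (continuous_const (y := g 0 m)))) ⟨m, hm, rfl⟩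
    have hw0 : g 0 w = g 0 m := hw.2
    refine ⟨w, hw.1, fun w' hw' => ?_⟩
    rcases (show g 0 w' ≤ g 0 m from hmax hw').lt_or_eq with h0 | h0
    · exact le_of_lt ⟨0, fun j hj => absurd hj (Fin.not_lt_zero j), by simpa [hw0] using h0⟩
    · rcases (hwmax w' ⟨hw', h0⟩).lt_or_eq with h | h
      · obtain ⟨i, hi, hlt⟩ := h
        refine le_of_lt ⟨i.succ, fun j hj => ?_, hlt⟩
        cases j using Fin.cases with
        | zero => exact h0.trans hw0.symm
        | succ j => exact hi j (Fin.succ_lt_succ_iff.1 hj)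
      · refine le_of_eq (congrArg toLex (funext fun j => ?_))
        cases j using Fin.cases with
        | zero => exact h0.trans hw0.symm
        | succ j => exact congrFun (toLex.injective h) j

section LexTriangulation

variable {E : Type*} [AddCommGroup E] [Module ℝ E] {n : ℕ}

/-- A finite set `σ` is a lexicographic face of the point configuration `p` if every system of
convex weights supported on `σ` is lexicographically maximal among all convex weights with the same
barycenter. -/
def IsLexFace (p : Fin n → E) (σ : Finset E) : Prop :=
  ∀ w ∈ stdSimplex ℝ (Fin n), ∀ w' ∈ stdSimplex ℝ (Fin n), (∀ i, w i ≠ 0 → p i ∈ σ) →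
    ∑ i, w' i • p i = ∑ i, w i • p i → toLex w' ≤ toLex w

theorem IsLexFace.mono {p : Fin n → E} {σ τ : Finset E} (hσ : IsLexFace p σ) (h : τ ⊆ σ) :
    IsLexFace p τ :=
  fun w hw w' hw' hsupp => hσ w hw w' hw' fun i hi => h (hsupp i hi)

/-- Reindexing a sum over a finite subset of the range of an injective family. -/
theorem sum_ite_mem_eq_sum_of_injective {α M : Type*} [DecidableEq α] [AddCommMonoid M]
    {p : Fin n → α} (hp : Function.Injective p) {σ : Finset α}
    (hσ : (σ : Set α) ⊆ Set.range p) (f : α → M) :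
    ∑ i, (if p i ∈ σ then f (p i) else 0) = ∑ y ∈ σ, f y := by
  rw [← Finset.sum_filter]
  refine Finset.sum_bij (fun i _ => p i) (by simp) (fun i _ j _ h => hp h) (fun y hy => ?_)
    (by simp)
  obtain ⟨i, rfl⟩ := hσ hy
  exact ⟨i, by simpa using hy, rfl⟩

/-- Points of the convex hull of a finite set are barycenters of weights indexed by any injective
family whose range contains that set. -/
theorem exists_weights_of_mem_convexHull {p : Fin n → E} (hp : Function.Injective p)
    {σ : Finset E} (hσ : (σ : Set E) ⊆ Set.range p) {x : E} (hx : x ∈ convexHull ℝ (σ : Set E)) :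
    ∃ w ∈ stdSimplex ℝ (Fin n), (∀ i, w i ≠ 0 → p i ∈ σ) ∧ ∑ i, w i • p i = x := by
  classical
  obtain ⟨u, hu0, hu1, hux⟩ := Finset.mem_convexHull'.1 hx
  refine ⟨fun i => if p i ∈ σ then u (p i) else 0, ⟨fun i => ?_, ?_⟩, fun i hi => ?_, ?_⟩
  · dsimp only
    split_ifs with h
    exacts [hu0 _ h, le_rfl]
  · rw [← hu1]
    exact sum_ite_mem_eq_sum_of_injective hp hσ u
  · by_contra h
    simp [h] at hi
  · rw [← hux, ← sum_ite_mem_eq_sum_of_injective hp hσ fun y => u y • y]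
    exact Finset.sum_congr rfl fun i _ => by by_cases h : p i ∈ σ <;> simp [h]

/-- Convex combinations of a family lie in the convex hull of any set containing the points of
nonzero weight. -/
theorem sum_smul_mem_convexHull_of_support {p : Fin n → E} {A : Set E} {w : Fin n → ℝ}
    (hw : w ∈ stdSimplex ℝ (Fin n)) (hA : ∀ i, w i ≠ 0 → p i ∈ A) :
    ∑ i, w i • p i ∈ convexHull ℝ A := by
  classical
  have h1 : ∑ i with w i ≠ 0, w i = 1 := by
    rw [Finset.sum_filter_ne_zero]; exact hw.2
  have h2 : ∑ i with w i ≠ 0, w i • p i = ∑ i, w i • p i :=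
    Finset.sum_filter_of_ne fun i _ h h0 => h (by simp [h0])
  rw [← h2]
  exact (convex_convexHull ℝ A).sum_mem (fun i _ => hw.1 i) h1
    fun i hi => subset_convexHull ℝ A (hA i (Finset.mem_filter.1 hi).2)

theorem IsLexFace.weights_eq {p : Fin n → E} {σ τ : Finset E} (hσ : IsLexFace p σ)
    (hτ : IsLexFace p τ) {w w' : Fin n → ℝ} (hw : w ∈ stdSimplex ℝ (Fin n))
    (hw' : w' ∈ stdSimplex ℝ (Fin n)) (hwσ : ∀ i, w i ≠ 0 → p i ∈ σ)
    (hwτ : ∀ i, w' i ≠ 0 → p i ∈ τ) (h : ∑ i, w' i • p i = ∑ i, w i • p i) : w = w' :=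
  toLex.injective (le_antisymm (hτ w' hw' w hw hwτ h.symm) (hσ w hw w' hw' hwσ h))

theorem IsLexFace.convexHull_inter_subset {p : Fin n → E} (hp : Function.Injective p)
    {σ τ : Finset E} (hσ : IsLexFace p σ) (hτ : IsLexFace p τ)
    (hσp : (σ : Set E) ⊆ Set.range p) (hτp : (τ : Set E) ⊆ Set.range p) :
    convexHull ℝ (σ : Set E) ∩ convexHull ℝ (τ : Set E) ⊆ convexHull ℝ (σ ∩ τ : Set E) := by
  rintro x ⟨hxσ, hxτ⟩
  obtain ⟨w, hw, hwσ, hwx⟩ := exists_weights_of_mem_convexHull hp hσp hxσ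
  obtain ⟨w', hw', hwτ, rfl⟩ := exists_weights_of_mem_convexHull hp hτp hxτ
  obtain rfl := hσ.weights_eq hτ hw hw' hwσ hwτ hwx.symm
  exact sum_smul_mem_convexHull_of_support hw fun i hi => ⟨hwσ i hi, hwτ i hi⟩

theorem IsLexFace.affineIndependent {p : Fin n → E} (hp : Function.Injective p)
    {σ : Finset E} (hσ : IsLexFace p σ) (hσp : (σ : Set E) ⊆ Set.range p) :
    AffineIndependent ℝ ((↑) : σ → E) := by
  classical
  by_contra hdep
  obtain ⟨I, x, hx, hx'⟩ := Convex.radon_partition hdep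
  let A : Finset E := σ.filter fun y => ∃ z ∈ I, (z : E) = y
  let B : Finset E := σ.filter fun y => ∃ z ∈ Iᶜ, (z : E) = y
  have hA : ((↑) : σ → E) '' I ⊆ A := by
    rintro _ ⟨z, hz, rfl⟩
    exact Finset.mem_filter.2 ⟨z.2, z, hz, rfl⟩
  have hB : ((↑) : σ → E) '' Iᶜ ⊆ B := by
    rintro _ ⟨z, hz, rfl⟩
    exact Finset.mem_filter.2 ⟨z.2, z, hz, rfl⟩
  have hAσ : A ⊆ σ := Finset.filter_subset _ _
  have hBσ : B ⊆ σ := Finset.filter_subset _ _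
  have hAB : (A ∩ B : Set E) = ∅ := by
    ext y
    simp only [Set.mem_inter_iff, Finset.mem_coe, Set.mem_empty_iff_false, iff_false, not_and]
    intro hyA hyB
    obtain ⟨-, z, hz, rfl⟩ := Finset.mem_filter.1 hyA
    obtain ⟨-, z', hz', h⟩ := Finset.mem_filter.1 hyB
    exact hz' (Subtype.ext h ▸ hz)
  have := (hσ.mono hAσ).convexHull_inter_subset hp (hσ.mono hBσ)
    ((Finset.coe_subset.2 hAσ).trans hσp) ((Finset.coe_subset.2 hBσ).trans hσp)
    ⟨convexHull_mono hA hx, convexHull_mono hB hx'⟩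
  simp [hAB] at this

/-- The support of lexicographically maximal weights is a lexicographic face. -/
theorem isLexFace_support [DecidableEq E] {p : Fin n → E} (hp : Function.Injective p)
    {w : Fin n → ℝ} (hw : w ∈ stdSimplex ℝ (Fin n))
    (hmax : ∀ w' ∈ stdSimplex ℝ (Fin n), ∑ i, w' i • p i = ∑ i, w i • p i →
      toLex w' ≤ toLex w) :
    IsLexFace p ((Finset.univ.filter fun i => w i ≠ 0).image p) := by
  intro v hv v' hv' hsupp heq
  have hsupp' : ∀ i, v i ≠ 0 → w i ≠ 0 := by
    intro i hi
    obtain ⟨j, hj, hji⟩ := Finset.mem_image.1 (hsupp i hi)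
    exact hp hji ▸ (Finset.mem_filter.1 hj).2
  obtain ⟨ε, hε, hle⟩ : ∃ ε : ℝ, 0 < ε ∧ ∀ i, ε * v i ≤ w i := by
    have hev : ∀ i, ∀ᶠ ε : ℝ in nhdsWithin 0 (Set.Ioi 0), ε * v i ≤ w i := by
      intro i
      by_cases hi : v i = 0
      · exact Filter.Eventually.of_forall fun ε => by simpa [hi] using hw.1 i
      · have hwi : 0 < w i := lt_of_le_of_ne (hw.1 i) (hsupp' i hi).symm
        have hcont : Filter.Tendsto (fun ε : ℝ => ε * v i) (nhds 0) (nhds 0) := by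
          have h : Continuous fun ε : ℝ => ε * v i := by fun_prop
          simpa using h.tendsto 0
        exact ((hcont.mono_left nhdsWithin_le_nhds).eventually_lt_const hwi).mono
          fun _ h => h.le
    obtain ⟨ε, hε, h⟩ :=
      (Filter.Eventually.and (eventually_mem_nhdsWithin (a := (0 : ℝ)) (s := Set.Ioi 0))
        (Filter.eventually_all.2 hev)).exists
    exact ⟨ε, hε, h⟩
  by_contra! hlt
  obtain ⟨i, hi, hlti⟩ := hlt
  have hlti' : v i < v' i := hlti
  refine (hmax (fun j => w j + ε * (v' j - v j)) ⟨fun j => ?_, ?_⟩ ?_).not_gt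
    ⟨i, fun j hj => ?_, ?_⟩
  · have h1 := hle j
    have h2 := mul_nonneg hε.le (hv'.1 j)
    linarith
  · rw [Finset.sum_add_distrib, ← Finset.mul_sum, Finset.sum_sub_distrib, hw.2, hv.2, hv'.2]
    simp
  · simp only [add_smul, mul_smul, sub_smul, Finset.sum_add_distrib, ← Finset.smul_sum,
      Finset.sum_sub_distrib, heq, sub_self, smul_zero, add_zero]
  · have : v j = v' j := hi j hj
    simp [this]
  · have := mul_pos hε (sub_pos.2 hlti')
    simpa using this

end LexTriangulation

/-- Every point of the convex hull of a finite family is a barycenter of positive weights on a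
lexicographic face. -/
theorem exists_weights_isLexFace_support {E : Type*} [NormedAddCommGroup E] [NormedSpace ℝ E]
    [DecidableEq E] {n : ℕ} {p : Fin n → E} (hp : Function.Injective p) {s : Finset E}
    (hs : (s : Set E) ⊆ Set.range p) {x : E} (hx : x ∈ convexHull ℝ (s : Set E)) :
    ∃ w ∈ stdSimplex ℝ (Fin n), ∑ i, w i • p i = x ∧
      IsLexFace p ((Finset.univ.filter fun i => w i ≠ 0).image p) := by
  obtain ⟨w₀, hw₀, -, hw₀x⟩ := exists_weights_of_mem_convexHull hp hs hx
  have hclosed : IsClosed {w : Fin n → ℝ | ∑ i, w i • p i = x} :=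
    isClosed_eq (by fun_prop) continuous_const
  obtain ⟨w, ⟨hw, hwx⟩, hmax⟩ := IsCompact.exists_isLexMax (fun i (w : Fin n → ℝ) => w i)
    (fun i => continuous_apply i) ((isCompact_stdSimplex ℝ (Fin n)).inter_right hclosed)
    ⟨w₀, hw₀, hw₀x⟩
  exact ⟨w, hw, hwx, isLexFace_support hp hw fun w' hw' h => hmax w' ⟨hw', h.trans hwx⟩⟩

/-- If a boundary point of a full-dimensional convex set is a convex combination with nonzero
weights of points of that set, then the whole convex hull of these points avoids the interior. -/
theorem Convex.disjoint_interior_convexHull_of_sum_mem {E : Type*} [NormedAddCommGroup E]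
    [NormedSpace ℝ E] {C : Set E} (hC : Convex ℝ C) (hne : (interior C).Nonempty)
    {ι : Type*} [Fintype ι] {p : ι → E} (hp : ∀ i, p i ∈ C) {w : ι → ℝ}
    (hw : w ∈ stdSimplex ℝ ι) (hx : ∑ i, w i • p i ∉ interior C) :
    Disjoint (convexHull ℝ (p '' {i | w i ≠ 0})) (interior C) := by
  obtain ⟨f, hf⟩ := geometric_hahn_banach_open_point hC.interior isOpen_interior hx
  set x := ∑ i, w i • p i with hxdef
  have hle : ∀ y ∈ C, f y ≤ f x := by
    intro y hy
    have hy' : y ∈ closure (interior C) := by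
      rw [hC.closure_interior_eq_closure_of_nonempty_interior hne]
      exact subset_closure hy
    exact closure_minimal (fun a ha => (hf a ha).le)
      (isClosed_le f.continuous continuous_const) hy'
  have hsum : ∑ i, w i * (f x - f (p i)) = 0 := by
    have hfx : f x = ∑ i, w i * f (p i) := by simp [hxdef, map_sum]
    simp only [mul_sub, Finset.sum_sub_distrib, ← Finset.sum_mul, hw.2, one_mul, ← hfx, sub_self]
  have heq : ∀ i, w i ≠ 0 → f (p i) = f x := by
    intro i hi
    have h := (Finset.sum_eq_zero_iff_of_nonneg fun i _ =>
      mul_nonneg (hw.1 i) (sub_nonneg.2 (hle _ (hp i)))).1 hsum i (Finset.mem_univ i)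
    linarith [(mul_eq_zero.1 h).resolve_left hi]
  have hsub : convexHull ℝ (p '' {i | w i ≠ 0}) ⊆ {y | f y = f x} := by
    refine convexHull_min ?_ (convex_hyperplane f.toLinearMap.isLinear (f x))
    rintro _ ⟨i, hi, rfl⟩
    exact heq i hi
  exact Set.disjoint_left.2 fun y hy hyC => (hf y hyC).ne (hsub hy)

/-- Let `d ≥ 1` and let `s` be a finite subset of `ℝ^d` whose convex hull has
nonempty interior. Then there is a geometric simplicial complex in `ℝ^d` whose vertex set is
contained in `s` and whose underlying space equals the topological boundary of the convex
hull of `s`. -/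
theorem boundary_triangulation (d : ℕ) (hd : 1 ≤ d) (s : Finset (Fin d → ℝ))
    (hs : (interior (convexHull ℝ (s : Set (Fin d → ℝ)))).Nonempty) :
    ∃ K : Geometry.SimplicialComplex ℝ (Fin d → ℝ),
      K.vertices ⊆ (s : Set (Fin d → ℝ)) ∧
      K.space = frontier (convexHull ℝ (s : Set (Fin d → ℝ))) := by
  classical
  set C := convexHull ℝ (s : Set (Fin d → ℝ))
  let p : Fin s.card → (Fin d → ℝ) := fun i => s.equivFin.symm i
  have hp : Function.Injective p := Subtype.val_injective.comp s.equivFin.symm.injective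
  have hps : ∀ i, p i ∈ s := fun i => (s.equivFin.symm i).2
  have hsp : (s : Set (Fin d → ℝ)) ⊆ Set.range p :=
    fun y hy => ⟨s.equivFin ⟨y, hy⟩, by simp [p]⟩
  have hCclosed : IsClosed C := s.finite_toSet.isClosed_convexHull ℝ
  let K : Geometry.SimplicialComplex ℝ (Fin d → ℝ) :=
    Geometry.SimplicialComplex.ofErase
      {σ | σ ⊆ s ∧ IsLexFace p σ ∧ convexHull ℝ (σ : Set (Fin d → ℝ)) ⊆ frontier C}
      (fun σ hσ => hσ.2.1.affineIndependent hp ((Finset.coe_subset.2 hσ.1).trans hsp))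
      (fun σ τ hτσ hσ => ⟨hτσ.trans hσ.1, hσ.2.1.mono hτσ,
        (convexHull_mono (Finset.coe_subset.2 hτσ)).trans hσ.2.2⟩)
      (fun σ hσ τ hτ => hσ.2.1.convexHull_inter_subset hp hτ.2.1
        ((Finset.coe_subset.2 hσ.1).trans hsp) ((Finset.coe_subset.2 hτ.1).trans hsp))
  refine ⟨K, fun v hv => hv.1.1 (Finset.mem_singleton_self v), Set.Subset.antisymm ?_ ?_⟩
  · exact Set.iUnion₂_subset fun σ hσ => hσ.1.2.2
  · intro x hx
    obtain ⟨w, hw, rfl, hface⟩ := exists_weights_isLexFace_support hp hsp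
      (hCclosed.frontier_subset hx)
    have hsub : (Finset.univ.filter fun i => w i ≠ 0).image p ⊆ s :=
      Finset.image_subset_iff.2 fun i _ => hps i
    have hC : Convex ℝ C := convex_convexHull ℝ _
    have hdisj := hC.disjoint_interior_convexHull_of_sum_mem hs
      (fun i => subset_convexHull ℝ _ (hps i)) hw hx.2
    have hxmem := sum_smul_mem_convexHull_of_support (p := p)
      (A := ((Finset.univ.filter fun i => w i ≠ 0).image p : Finset _)) hw
      fun i hi => Finset.mem_image_of_mem p (by simpa using hi)
    refine Geometry.SimplicialComplex.mem_space_iff.2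
      ⟨_, ⟨⟨hsub, hface, fun y hy => ?_⟩, ?_⟩, hxmem⟩
    · refine ⟨subset_closure (convexHull_mono (Finset.coe_subset.2 hsub) hy), ?_⟩
      exact Set.disjoint_left.1 hdisj (by simpa using hy)
    · intro h
      rw [Set.mem_singleton_iff.1 h] at hxmem
      simp at hxmem
end
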